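/- On the quarter disc Ω = {(r,θ) : 0 < r < 1, 0 < θ < π/2}, the function u(r,θ) = r^{1/2} sin(θ/2) is harmonic, vanishes on the boundary segment {θ = 0}, satisfies the oblique derivative condition ∇u · ν = 0 with ν = (−1,−1) on the segment {θ = π/2}, and u is Hölder continuous of exponent 1/2 but not Lipschitz at the origin (i.e., u(r, θ₀)/r → ∞ as r → 0 for any fixed θ₀ ∈ (0, π/2]). -/

import Mathlib

open Real Set Filter


lemma corner_div {f g : ℝ × ℝ → ℝ} {f' g' : ℝ × ℝ →L[ℝ] ℝ} {p : ℝ × ℝ}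
    (hf : HasFDerivAt f f' p) (hg : HasFDerivAt g g' p) (h : g p ≠ 0) :
    HasFDerivAt (fun q => f q / g q) ((1 / g p) • f' - (f p / g p ^ 2) • g') p := by
  have h1 : HasFDerivAt (fun q => (g q)⁻¹) _ p := (hasDerivAt_inv h).comp_hasFDerivAt p hg
  have h2 := hf.fun_mul h1
  simp only [div_eq_mul_inv]
  refine h2.congr_fderiv ?_
  ext <;> simp <;> ring

lemma corner_hasFDerivAt (u : ℝ × ℝ → ℝ)
    (hu : ∀ p : ℝ × ℝ, u p = Real.sqrt ((Real.sqrt (p.1 ^ 2 + p.2 ^ 2) - p.1) / 2))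
    (p : ℝ × ℝ) (hp : 0 < p.2) :
    0 < Real.sqrt (p.1 ^ 2 + p.2 ^ 2) ∧ 0 < u p ∧
    u p ^ 2 = (Real.sqrt (p.1 ^ 2 + p.2 ^ 2) - p.1) / 2 ∧
    HasFDerivAt (fun p : ℝ × ℝ => Real.sqrt (p.1 ^ 2 + p.2 ^ 2))
      ((p.1 / Real.sqrt (p.1 ^ 2 + p.2 ^ 2)) • ContinuousLinearMap.fst ℝ ℝ ℝ
        + (p.2 / Real.sqrt (p.1 ^ 2 + p.2 ^ 2)) • ContinuousLinearMap.snd ℝ ℝ ℝ) p ∧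
    HasFDerivAt u ((-(u p / (2 * Real.sqrt (p.1 ^ 2 + p.2 ^ 2)))) • ContinuousLinearMap.fst ℝ ℝ ℝ
        + (p.2 / (4 * Real.sqrt (p.1 ^ 2 + p.2 ^ 2) * u p)) • ContinuousLinearMap.snd ℝ ℝ ℝ) p := by
  have hs : 0 < p.1 ^ 2 + p.2 ^ 2 := by positivity
  have hR : 0 < Real.sqrt (p.1 ^ 2 + p.2 ^ 2) := Real.sqrt_pos.2 hs
  have hg : 0 < (Real.sqrt (p.1 ^ 2 + p.2 ^ 2) - p.1) / 2 := by
    have : p.1 < Real.sqrt (p.1 ^ 2 + p.2 ^ 2) := by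
      apply Real.lt_sqrt_of_sq_lt
      nlinarith
    linarith
  have hup : 0 < u p := by rw [hu]; exact Real.sqrt_pos.2 hg
  have hu2 : u p ^ 2 = (Real.sqrt (p.1 ^ 2 + p.2 ^ 2) - p.1) / 2 := by
    rw [hu]; exact Real.sq_sqrt hg.le
  have h1 : HasFDerivAt (fun q : ℝ × ℝ => q.1) (ContinuousLinearMap.fst ℝ ℝ ℝ) p := hasFDerivAt_fst
  have h2 : HasFDerivAt (fun q : ℝ × ℝ => q.2) (ContinuousLinearMap.snd ℝ ℝ ℝ) p := hasFDerivAt_snd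
  have hRd : HasFDerivAt (fun p : ℝ × ℝ => Real.sqrt (p.1 ^ 2 + p.2 ^ 2))
      ((p.1 / Real.sqrt (p.1 ^ 2 + p.2 ^ 2)) • ContinuousLinearMap.fst ℝ ℝ ℝ
        + (p.2 / Real.sqrt (p.1 ^ 2 + p.2 ^ 2)) • ContinuousLinearMap.snd ℝ ℝ ℝ) p := by
    have := ((h1.pow 2).add (h2.pow 2)).sqrt hs.ne'
    refine this.congr_fderiv ?_
    ext <;> simp <;> field_simp
  refine ⟨hR, hup, hu2, hRd, ?_⟩
  have hud := ((hRd.sub h1).mul_const (1 / 2 : ℝ)).sqrt (by simpa [div_eq_mul_inv] using hg.ne')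
  have hue : u = fun q : ℝ × ℝ => Real.sqrt ((Real.sqrt (q.1 ^ 2 + q.2 ^ 2) - q.1) * (1 / 2)) := by
    funext q; rw [hu, div_eq_mul_one_div]
  have hue' : Real.sqrt ((Real.sqrt (p.1 ^ 2 + p.2 ^ 2) - p.1) * (1 / 2)) = u p := by rw [hue]
  refine HasFDerivAt.congr_fderiv (hud.congr_of_eventuallyEq
    (Filter.Eventually.of_forall fun q => congrFun hue q)) ?_
  simp only [Pi.sub_apply]
  rw [hue']
  generalize Real.sqrt (p.1 ^ 2 + p.2 ^ 2) = R at *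
  ext
  · simp
    field_simp
    rw [hu2]; ring
  · simp
    field_simp
    try norm_num

lemma corner_holder (u : ℝ × ℝ → ℝ)
    (hu : ∀ p : ℝ × ℝ, u p = Real.sqrt ((Real.sqrt (p.1 ^ 2 + p.2 ^ 2) - p.1) / 2))
    (p q : ℝ × ℝ) : dist (u p) (u q) ≤ 2 * Real.sqrt (dist p q) := by
  have key : ∀ a b : ℝ, 0 ≤ b → Real.sqrt a - Real.sqrt b ≤ Real.sqrt |a - b| := by
    intro a b hb
    have h : a ≤ (Real.sqrt b + Real.sqrt |a - b|) ^ 2 := by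
      have e1 := Real.sq_sqrt hb
      have e2 := Real.sq_sqrt (abs_nonneg (a - b))
      have := le_abs_self (a - b)
      nlinarith [mul_nonneg (Real.sqrt_nonneg b) (Real.sqrt_nonneg |a - b|)]
    have := Real.sqrt_le_sqrt h
    rw [Real.sqrt_sq (by positivity)] at this
    linarith
  have main : ∀ p q : ℝ × ℝ, u p - u q ≤ 2 * Real.sqrt (dist p q) := by
    intro p q
    have hd1 : |p.1 - q.1| ≤ dist p q := by
      rw [Prod.dist_eq, Real.dist_eq]; exact le_max_left _ _
    have hd2 : |p.2 - q.2| ≤ dist p q := by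
      rw [Prod.dist_eq, Real.dist_eq, Real.dist_eq]; exact le_max_right _ _
    have hR : ∀ p q : ℝ × ℝ, Real.sqrt (p.1 ^ 2 + p.2 ^ 2) - Real.sqrt (q.1 ^ 2 + q.2 ^ 2)
        ≤ |p.1 - q.1| + |p.2 - q.2| := by
      intro p q
      have ec : ∀ a : ℝ × ℝ, Real.sqrt (a.1 ^ 2 + a.2 ^ 2) = ‖(⟨a.1, a.2⟩ : ℂ)‖ := by
        intro a
        rw [Complex.norm_def, Complex.normSq_mk]; congr 1; ring
      rw [ec, ec]
      refine (norm_sub_norm_le _ _).trans ?_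
      refine (Complex.norm_le_abs_re_add_abs_im _).trans ?_
      simp
    have hR1 := hR p q
    have hR2 := hR q p
    rw [abs_sub_comm q.1, abs_sub_comm q.2] at hR2
    rw [hu p, hu q]
    refine (key _ _ ?_).trans ?_
    · have : q.1 ≤ Real.sqrt (q.1 ^ 2 + q.2 ^ 2) := Real.le_sqrt_of_sq_le (by nlinarith)
      linarith
    · have : (2 : ℝ) * Real.sqrt (dist p q) = Real.sqrt (4 * dist p q) := by
        rw [Real.sqrt_mul (by norm_num)]
        congr 1
        rw [show (4 : ℝ) = 2 ^ 2 by norm_num, Real.sqrt_sq (by norm_num)]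
      rw [this]
      apply Real.sqrt_le_sqrt
      have h1 := abs_le.1 hd1
      have h0 : 0 ≤ dist p q := dist_nonneg
      rw [abs_le]
      constructor <;> linarith [h1.1, h1.2]
  rw [Real.dist_eq, abs_le]
  constructor
  · have := main q p
    rw [dist_comm] at this
    linarith
  · exact main p q

/-- The corner singularity example of Section 9: on the quarter disc,
`u = r^{1/2} sin(θ/2)` (equivalently `u(x,y) = √((√(x²+y²) - x)/2)` for `y ≥ 0`)
is harmonic, vanishes on `{θ = 0}`, satisfies the oblique condition `∇u·(-1,-1) = 0`
on `{θ = π/2}`, is `C^{1/2}` (Hölder of exponent 1/2), but not Lipschitz at the origin. -/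
theorem corner_singularity_example
    (u : ℝ × ℝ → ℝ)
    (hu : ∀ p : ℝ × ℝ, u p = Real.sqrt ((Real.sqrt (p.1 ^ 2 + p.2 ^ 2) - p.1) / 2)) :
    -- harmonic on the open quarter disc
    (∀ p : ℝ × ℝ, 0 < p.1 → 0 < p.2 → p.1 ^ 2 + p.2 ^ 2 < 1 →
      fderiv ℝ (fun q => fderiv ℝ u q ((1, 0) : ℝ × ℝ)) p ((1, 0) : ℝ × ℝ)
        + fderiv ℝ (fun q => fderiv ℝ u q ((0, 1) : ℝ × ℝ)) p ((0, 1) : ℝ × ℝ) = 0) ∧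
    -- vanishes on the boundary segment θ = 0
    (∀ x : ℝ, 0 < x → x < 1 → u (x, 0) = 0) ∧
    -- oblique derivative condition on θ = π/2
    (∀ y : ℝ, 0 < y → y < 1 → fderiv ℝ u ((0, y) : ℝ × ℝ) ((-1, -1) : ℝ × ℝ) = 0) ∧
    -- Hölder continuity of exponent 1/2
    (∃ C : NNReal, HolderWith C (1 / 2) u) ∧
    -- not Lipschitz at the origin
    (∀ θ₀ : ℝ, 0 < θ₀ → θ₀ ≤ Real.pi / 2 →
      Tendsto (fun r : ℝ => u (r * Real.cos θ₀, r * Real.sin θ₀) / r)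
        (nhdsWithin 0 (Ioi 0)) atTop) := by
  refine ⟨?_, ?_, ?_, ?_, ?_⟩
  · intro p _ hp _
    obtain ⟨hR, hup, hu2, hRd, hud⟩ := corner_hasFDerivAt u hu p hp
    have hev : ∀ᶠ q : ℝ × ℝ in nhds p, 0 < q.2 :=
      continuous_snd.continuousAt.eventually (lt_mem_nhds hp)
    have e1 : (fun q => fderiv ℝ u q ((1, 0) : ℝ × ℝ)) =ᶠ[nhds p]
        fun q => -(u q / (2 * Real.sqrt (q.1 ^ 2 + q.2 ^ 2))) := by
      filter_upwards [hev] with q hq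
      rw [(corner_hasFDerivAt u hu q hq).2.2.2.2.fderiv]
      simp
    have e2 : (fun q => fderiv ℝ u q ((0, 1) : ℝ × ℝ)) =ᶠ[nhds p]
        fun q => (q.2 / (4 * Real.sqrt (q.1 ^ 2 + q.2 ^ 2) * u q)) := by
      filter_upwards [hev] with q hq
      rw [(corner_hasFDerivAt u hu q hq).2.2.2.2.fderiv]
      simp
    rw [e1.fderiv_eq, e2.fderiv_eq]
    have h2 : HasFDerivAt (fun q : ℝ × ℝ => q.2) (ContinuousLinearMap.snd ℝ ℝ ℝ) p :=
      hasFDerivAt_snd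
    have d1 := (corner_div hud (hRd.const_mul 2) (by positivity)).fun_neg
    have d2 := corner_div h2 ((hRd.const_mul 4).fun_mul hud) (by positivity)
    rw [d1.fderiv, d2.fderiv]
    have hR2 : Real.sqrt (p.1 ^ 2 + p.2 ^ 2) ^ 2 = p.1 ^ 2 + p.2 ^ 2 :=
      Real.sq_sqrt (by positivity)
    generalize Real.sqrt (p.1 ^ 2 + p.2 ^ 2) = R at *
    generalize u p = U at *
    obtain ⟨x, y⟩ := p
    simp at *
    field_simp
    have hx : x = R - 2 * U ^ 2 := by linarith
    have hy : y ^ 2 = 4 * U ^ 2 * (R - U ^ 2) := by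
      rw [hx] at hR2; nlinarith
    subst hx
    ring_nf
    rw [hy]
    ring
  · intro x hx _
    rw [hu]
    simp [Real.sqrt_sq hx.le]
  · intro y hy _
    obtain ⟨hR, hup, hu2, hRd, hud⟩ := corner_hasFDerivAt u hu (0, y) hy
    rw [hud.fderiv]
    simp [Real.sqrt_sq hy.le] at *
    field_simp
    nlinarith
  · refine ⟨2, fun p q => ?_⟩
    have h := corner_holder u hu p q
    rw [edist_nndist, edist_nndist, ← ENNReal.coe_rpow_of_nonneg _ (by positivity)]
    norm_cast
    rw [← NNReal.coe_le_coe]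
    push_cast
    rw [← Real.sqrt_eq_rpow]
    exact h
  · intro θ h0 h1
    have hc : Real.cos θ < 1 := by
      rw [← Real.cos_zero]
      exact Real.cos_lt_cos_of_nonneg_of_le_pi le_rfl (by linarith [Real.pi_pos]) h0
    have hk : 0 < Real.sqrt ((1 - Real.cos θ) / 2) := Real.sqrt_pos.2 (by linarith)
    have ht : Tendsto (fun r : ℝ => Real.sqrt ((1 - Real.cos θ) / 2) * (Real.sqrt r)⁻¹)
        (nhdsWithin 0 (Ioi 0)) atTop := by
      apply Tendsto.const_mul_atTop hk
      apply tendsto_inv_nhdsGT_zero.comp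
      rw [tendsto_nhdsWithin_iff]
      constructor
      · have := Real.continuous_sqrt.tendsto 0
        rw [Real.sqrt_zero] at this
        exact this.mono_left nhdsWithin_le_nhds
      · filter_upwards [self_mem_nhdsWithin] with r hr
        exact Real.sqrt_pos.2 hr
    refine ht.congr' ?_
    filter_upwards [self_mem_nhdsWithin] with r hr
    have hr' : 0 < r := hr
    rw [hu]
    have e : (r * Real.cos θ) ^ 2 + (r * Real.sin θ) ^ 2 = r ^ 2 := by
      nlinarith [Real.sin_sq_add_cos_sq θ]
    simp only [e]
    rw [Real.sqrt_sq hr'.le, show (r - r * Real.cos θ) / 2 = (1 - Real.cos θ) / 2 * r by ring,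
      Real.sqrt_mul (by linarith)]
    have hs := Real.sqrt_pos.2 hr'
    have hs2 := Real.sq_sqrt hr'.le
    field_simp
    rw [hs2]
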